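/- Let K ⊆ ℝ be a real quadratic number field, (A_n)_{n≥0} a sequence of elements of K, and D a positive integer. Then the sequence (ℓ(A_n))_n of period lengths is bounded if and only if the sequence (ℓ(D·A_n))_n is bounded. -/

import Mathlib

open Polynomial Filter

/-- The Gauss map used to generate the continued fraction expansion of a real number. -/
noncomputable def cfMap (x : ℝ) : ℝ := if Int.fract x = 0 then 0 else (Int.fract x)⁻¹

/-- The `i`-th partial quotient `a_i(x)` of the continued fraction expansion of `x`. -/
noncomputable def cfa (x : ℝ) (i : ℕ) : ℤ := ⌊cfMap^[i] x⌋

/-- The minimal eventual period length `ℓ(x)` of the continued fraction expansion of `x`,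
with the convention `ℓ(x) = 0` for rational `x`. -/
noncomputable def periodLength (x : ℝ) : ℕ :=
  open scoped Classical in
  if Irrational x then sInf {p : ℕ | 0 < p ∧ ∃ N : ℕ, ∀ n ≥ N, cfa x (n + p) = cfa x n} else 0

/-! ### Basic facts on the Gauss map -/

lemma fract_ne_zero_of_irrational {x : ℝ} (hx : Irrational x) : Int.fract x ≠ 0 := by
  intro h
  refine hx.ne_int ⌊x⌋ ?_
  linarith [Int.self_sub_floor x]

lemma cfMap_of_irrational {x : ℝ} (hx : Irrational x) : cfMap x = (Int.fract x)⁻¹ := by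
  rw [cfMap, if_neg (fract_ne_zero_of_irrational hx)]

lemma irrational_cfMap {x : ℝ} (hx : Irrational x) : Irrational (cfMap x) := by
  rw [cfMap_of_irrational hx, irrational_inv_iff, ← Int.self_sub_floor]
  exact hx.sub_intCast _

lemma one_lt_cfMap {x : ℝ} (hx : Irrational x) : 1 < cfMap x := by
  rw [cfMap_of_irrational hx]
  exact (one_lt_inv₀ ((Int.fract_nonneg x).lt_of_ne' (fract_ne_zero_of_irrational hx))).2
    (Int.fract_lt_one x)

lemma eq_floor_add_inv_cfMap {x : ℝ} (hx : Irrational x) : x = ⌊x⌋ + (cfMap x)⁻¹ := by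
  rw [cfMap_of_irrational hx, inv_inv, Int.floor_add_fract]

lemma irrational_iterate_cfMap {x : ℝ} (hx : Irrational x) (n : ℕ) :
    Irrational (cfMap^[n] x) := by
  induction n with
  | zero => exact hx
  | succ n ih => rw [Function.iterate_succ_apply']; exact irrational_cfMap ih

lemma cfa_iterate (x : ℝ) (m n : ℕ) : cfa (cfMap^[m] x) n = cfa x (n + m) := by
  rw [cfa, cfa, Function.iterate_add_apply]

lemma cfa_cfMap (x : ℝ) (n : ℕ) : cfa (cfMap x) n = cfa x (n + 1) := cfa_iterate x 1 n

/-- Two numbers greater than one with the same partial quotients are exponentially close. -/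
lemma abs_sub_le_of_cfa_eq (n : ℕ) : ∀ {x y : ℝ}, Irrational x → Irrational y → 1 < x → 1 < y →
    (∀ i, cfa x i = cfa y i) → |x - y| ≤ (1 / 2) ^ n * ((x + 1) * (y + 1)) := by
  induction n with
  | zero =>
    intro x y _ _ hx hy _
    rw [abs_le]
    constructor <;> nlinarith
  | succ n ih =>
    intro x y hxi hyi hx hy h
    have hx' := one_lt_cfMap hxi
    have hy' := one_lt_cfMap hyi
    have key := ih (irrational_cfMap hxi) (irrational_cfMap hyi) hx' hy'
      (fun i => by rw [cfa_cfMap, cfa_cfMap, h])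
    have ex := eq_floor_add_inv_cfMap hxi
    have ey := eq_floor_add_inv_cfMap hyi
    have h0 : ⌊x⌋ = ⌊y⌋ := h 0
    have hf : (1 : ℝ) ≤ ⌊y⌋ := by exact_mod_cast Int.le_floor.2 (by exact_mod_cast hy.le)
    rw [h0] at ex
    generalize cfMap x = u at *
    generalize cfMap y = v at *
    generalize (⌊y⌋ : ℝ) = a at *
    have hu : 0 < u⁻¹ := by positivity
    have hv : 0 < v⁻¹ := by positivity
    have hu1 : u⁻¹ < 1 := inv_lt_one_of_one_lt₀ hx'
    have hv1 : v⁻¹ < 1 := inv_lt_one_of_one_lt₀ hy'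
    have hsub : x - y = (v - u) * (u⁻¹ * v⁻¹) := by
      rw [ex, ey]; field_simp; ring
    have hmul : 2 * ((1 + u⁻¹) * (1 + v⁻¹)) ≤ (x + 1) * (y + 1) := by
      have h1 : 2 + u⁻¹ ≤ x + 1 := by linarith
      have h2 : 2 + v⁻¹ ≤ y + 1 := by linarith
      calc 2 * ((1 + u⁻¹) * (1 + v⁻¹)) ≤ (2 + u⁻¹) * (2 + v⁻¹) := by nlinarith
        _ ≤ (x + 1) * (y + 1) := by gcongr
    rw [hsub, abs_mul, abs_sub_comm, abs_of_pos (mul_pos hu hv)]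
    calc |u - v| * (u⁻¹ * v⁻¹)
        ≤ ((1 / 2) ^ n * ((u + 1) * (v + 1))) * (u⁻¹ * v⁻¹) := by gcongr
      _ = (1 / 2) ^ (n + 1) * (2 * ((1 + u⁻¹) * (1 + v⁻¹))) := by
        rw [pow_succ]; field_simp
      _ ≤ (1 / 2) ^ (n + 1) * ((x + 1) * (y + 1)) := by gcongr

/-- An irrational number is determined by its partial quotients. -/
lemma eq_of_cfa_eq {x y : ℝ} (hx : Irrational x) (hy : Irrational y)
    (h : ∀ i, cfa x i = cfa y i) : x = y := by
  have h0 : ⌊x⌋ = ⌊y⌋ := h 0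
  have hu : cfMap x = cfMap y := by
    refine eq_of_abs_sub_eq_zero (le_antisymm ?_ (abs_nonneg _))
    have hlim : Tendsto (fun n : ℕ => (1 / 2 : ℝ) ^ n * ((cfMap x + 1) * (cfMap y + 1)))
        atTop (nhds (0 * ((cfMap x + 1) * (cfMap y + 1)))) :=
      (tendsto_pow_atTop_nhds_zero_of_lt_one (by norm_num) (by norm_num)).mul_const _
    rw [zero_mul] at hlim
    refine ge_of_tendsto' hlim fun n => ?_
    exact abs_sub_le_of_cfa_eq n (irrational_cfMap hx) (irrational_cfMap hy) (one_lt_cfMap hx)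
      (one_lt_cfMap hy) (fun i => by rw [cfa_cfMap, cfa_cfMap, h])
  rw [eq_floor_add_inv_cfMap hx, eq_floor_add_inv_cfMap hy, h0, hu]

/-! ### Eventual periods -/

/-- `p` is a positive eventual period of the orbit of `x` under the Gauss map. -/
def IsOrbitPeriod (x : ℝ) (p : ℕ) : Prop :=
  0 < p ∧ ∃ N : ℕ, cfMap^[N + p] x = cfMap^[N] x

lemma isOrbitPeriod_iff_cfa {x : ℝ} (hx : Irrational x) (p : ℕ) :
    IsOrbitPeriod x p ↔ 0 < p ∧ ∃ N : ℕ, ∀ n ≥ N, cfa x (n + p) = cfa x n := by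
  refine and_congr_right fun _ => exists_congr fun N => ⟨fun h n hn => ?_, fun h => ?_⟩
  · obtain ⟨k, rfl⟩ := Nat.exists_eq_add_of_le hn
    rw [show N + k + p = k + (N + p) by ring, show N + k = k + N by ring, ← cfa_iterate,
      ← cfa_iterate, h]
  · refine eq_of_cfa_eq (irrational_iterate_cfMap hx _) (irrational_iterate_cfMap hx _) fun i => ?_
    rw [cfa_iterate, cfa_iterate, ← h (i + N) (by omega), add_assoc]

lemma periodLength_of_irrational {x : ℝ} (hx : Irrational x) :
    periodLength x = sInf {p : ℕ | IsOrbitPeriod x p} := by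
  simp only [periodLength, if_pos hx, isOrbitPeriod_iff_cfa hx]

lemma IsOrbitPeriod.of_iterate_eq {x y : ℝ} {p m n : ℕ} (hp : IsOrbitPeriod x p)
    (h : cfMap^[m] x = cfMap^[n] y) : IsOrbitPeriod y p := by
  obtain ⟨h0, N, hN⟩ := hp
  refine ⟨h0, N + n, ?_⟩
  have e1 : cfMap^[N + p + m] x = cfMap^[N + n + p] y := by
    rw [Function.iterate_add_apply, h, ← Function.iterate_add_apply]; congr 1; omega
  have e2 : cfMap^[N + m] x = cfMap^[N + n] y := by
    rw [Function.iterate_add_apply, h, ← Function.iterate_add_apply]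
  rw [← e1, ← e2, show N + p + m = m + (N + p) by ring, Function.iterate_add_apply, hN,
    ← Function.iterate_add_apply, add_comm]

/-! ### Tail equivalence with bounded shift -/

/-- The square root of the absolute value of the derivative of `cfMap^[n]` at `x`. -/
noncomputable def expansion (n : ℕ) (x : ℝ) : ℝ :=
  ∏ i ∈ Finset.range n, (Int.fract (cfMap^[i] x))⁻¹

lemma expansion_add (m n : ℕ) (x : ℝ) :
    expansion (m + n) x = expansion m x * expansion n (cfMap^[m] x) := by
  simp only [expansion, Finset.prod_range_add, ← Function.iterate_add_apply, add_comm]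

lemma expansion_pos {x : ℝ} (hx : Irrational x) (n : ℕ) : 0 < expansion n x :=
  Finset.prod_pos fun _ _ => inv_pos.2 ((Int.fract_nonneg _).lt_of_ne'
    (fract_ne_zero_of_irrational (irrational_iterate_cfMap hx _)))

/-- The orbits of `y` and `z` under the Gauss map merge, after numbers of steps which differ by at
most `k`; the weights `s` and `t` record the ratio of the expansions along the two orbits. -/
def TailEquiv (k : ℕ) (y s z t : ℝ) : Prop :=
  ∃ m n : ℕ, m ≤ n + k ∧ n ≤ m + k ∧ cfMap^[m] y = cfMap^[n] z ∧
    s * expansion m y = t * expansion n z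

namespace TailEquiv

lemma refl (y s : ℝ) : TailEquiv 0 y s y s := ⟨0, 0, by simp⟩

lemma trans {k l : ℕ} {y s z t w r : ℝ} (h₁ : TailEquiv k y s z t) (h₂ : TailEquiv l z t w r) :
    TailEquiv (k + l) y s w r := by
  obtain ⟨m, n, hm, hn, h, he⟩ := h₁
  obtain ⟨m', n', hm', hn', h', he'⟩ := h₂
  refine ⟨m + m', n' + n, by omega, by omega, ?_, ?_⟩
  · rw [add_comm m, Function.iterate_add_apply, h, ← Function.iterate_add_apply, add_comm,
      Function.iterate_add_apply, h', ← Function.iterate_add_apply, add_comm]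
  · have e : expansion n z * expansion m' (cfMap^[n] z)
        = expansion m' z * expansion n (cfMap^[m'] z) := by
      rw [← expansion_add, ← expansion_add, add_comm]
    rw [expansion_add, expansion_add, h, ← h', ← mul_assoc, ← mul_assoc, he, ← he', mul_assoc,
      mul_assoc, e]

lemma mono {k l : ℕ} {y s z t : ℝ} (h : TailEquiv k y s z t) (hkl : k ≤ l) :
    TailEquiv l y s z t := by
  obtain ⟨m, n, hm, hn, h⟩ := h
  exact ⟨m, n, by omega, by omega, h⟩

lemma scale {k : ℕ} {y s z t : ℝ} (h : TailEquiv k y s z t) (c : ℝ) :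
    TailEquiv k y (c * s) z (c * t) := by
  obtain ⟨m, n, hm, hn, h, he⟩ := h
  exact ⟨m, n, hm, hn, h, by rw [mul_assoc, he, mul_assoc]⟩

lemma add_int (y s : ℝ) (n : ℤ) : TailEquiv 0 y s (y + n) s :=
  ⟨1, 1, by simp, by simp, by simp [cfMap], by simp [expansion]⟩

lemma inv_of_pos {y : ℝ} (hy : Irrational y) (h0 : 0 < y) (s : ℝ) :
    TailEquiv 1 y s y⁻¹ (s / y) := by
  rcases lt_or_gt_of_ne hy.ne_one with h1 | h1
  · have hf : Int.fract y = y := Int.fract_eq_self.2 ⟨h0.le, h1⟩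
    refine ⟨1, 0, by simp, by simp, ?_, ?_⟩
    · simp [cfMap_of_irrational hy, hf]
    · simp [expansion, hf, div_eq_mul_inv]
  · have hf : Int.fract y⁻¹ = y⁻¹ :=
      Int.fract_eq_self.2 ⟨by positivity, inv_lt_one_of_one_lt₀ h1⟩
    refine ⟨0, 1, by simp, by simp, ?_, ?_⟩
    · simp [cfMap_of_irrational hy.inv, hf]
    · simp [expansion, hf, h0.ne']

lemma neg {y : ℝ} (hy : Irrational y) (s : ℝ) : TailEquiv 3 y s (-y) s := by
  have hz := irrational_cfMap hy
  have hz1 := one_lt_cfMap hy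
  have hyz := eq_floor_add_inv_cfMap hy
  generalize cfMap y = z at *
  generalize ⌊y⌋ = a at *
  have hz' : Irrational (z - 1) := by simpa using hz.sub_intCast 1
  have hz'' : Irrational ((z - 1)⁻¹ + 1) := by simpa using hz'.inv.add_intCast 1
  have hpos : 0 < z - 1 := by linarith
  have hpos' : 0 < z := by linarith
  have h1 := add_int y s (-a)
  rw [show y + ((-a : ℤ) : ℝ) = z⁻¹ by push_cast; linarith] at h1
  have h2 := inv_of_pos hz.inv (inv_pos.2 hpos') s
  rw [inv_inv, div_inv_eq_mul] at h2
  have h3 := add_int z (s * z) (-1)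
  rw [show z + ((-1 : ℤ) : ℝ) = z - 1 by push_cast; ring] at h3
  have h4 := inv_of_pos hz' hpos (s * z)
  have h5 := add_int (z - 1)⁻¹ (s * z / (z - 1)) 1
  rw [Int.cast_one] at h5
  have h6 := inv_of_pos hz'' (by positivity) (s * z / (z - 1))
  rw [show s * z / (z - 1) / ((z - 1)⁻¹ + 1) = s by field_simp; ring] at h6
  have h7 := add_int ((z - 1)⁻¹ + 1)⁻¹ s (-a - 1)
  rw [show ((z - 1)⁻¹ + 1)⁻¹ + ((-a - 1 : ℤ) : ℝ) = -y by
    rw [hyz]; push_cast; field_simp; ring] at h7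
  exact (((((h1.trans h2).trans h3).trans h4).trans h5).trans h6).trans h7

lemma inv {y : ℝ} (hy : Irrational y) (s : ℝ) : TailEquiv 7 y s y⁻¹ (s / |y|) := by
  rcases lt_or_gt_of_ne hy.ne_zero with h | h
  · have h1 := (neg hy s).trans (inv_of_pos hy.neg (neg_pos.2 h) s)
    have h2 := h1.trans (neg hy.neg.inv (s / -y))
    rwa [inv_neg, neg_neg, ← abs_of_neg h] at h2
  · rw [abs_of_pos h]
    exact (inv_of_pos hy h s).mono (by norm_num)

/-- A number which is tail equivalent to itself with distinct weights is eventually periodic. -/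
lemma exists_isOrbitPeriod {k : ℕ} {y s t : ℝ} (hy : Irrational y) (h : TailEquiv k y s y t)
    (hst : s ≠ t) : ∃ p ≤ k, IsOrbitPeriod y p := by
  obtain ⟨m, n, hm, hn, h, he⟩ := h
  rcases lt_trichotomy m n with hmn | rfl | hmn
  · exact ⟨n - m, by omega, by omega, m, by rw [h]; congr 1; omega⟩
  · exact absurd (mul_right_cancel₀ (expansion_pos hy m).ne' he) hst
  · exact ⟨m - n, by omega, by omega, n, by rw [← h]; congr 1; omega⟩

end TailEquiv

/-! ### Reduction of Möbius transformations -/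

lemma irrational_moebius {x : ℝ} (hx : Irrational x) {a b c d : ℤ} (hdet : a * d - b * c ≠ 0) :
    Irrational ((a * x + b) / (c * x + d)) := by
  have hden : (c : ℝ) * x + d ≠ 0 := by
    intro h
    by_cases hc : c = 0
    · subst hc
      have hd : d = 0 := by simpa using h
      simp [hd] at hdet
    · exact ((hx.intCast_mul hc).add_intCast d).ne_zero h
  rintro ⟨r, hr⟩
  rw [eq_div_iff hden] at hr
  have h : ((a - r * c : ℚ) : ℝ) * x = ((r * d - b : ℚ) : ℝ) := by push_cast; linarith
  by_cases h0 : (a - r * c : ℚ) = 0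
  · have h1 : (r * d - b : ℚ) = 0 := by
      rw [h0, Rat.cast_zero, zero_mul] at h
      exact_mod_cast h.symm
    apply hdet
    have : (a * d - b * c : ℚ) = 0 := by linear_combination (d : ℚ) * h0 + (c : ℚ) * h1
    exact_mod_cast this
  · exact (hx.ratCast_mul h0).ne_rat _ h

/-- `(α, β, δ)` codes a reduced upper triangular matrix of determinant `D`. -/
def IsHermite (D : ℕ) (T : ℕ × ℕ × ℕ) : Prop := T.1 * T.2.2 = D ∧ T.2.1 < T.2.2

/-- The action of the upper triangular matrix coded by `(α, β, δ)` on the real line. -/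
noncomputable def hermiteAct (T : ℕ × ℕ × ℕ) (x : ℝ) : ℝ := (T.1 * x + T.2.1) / T.2.2

lemma irrational_hermiteAct {D : ℕ} (hD : 0 < D) {T : ℕ × ℕ × ℕ} (hT : IsHermite D T) {x : ℝ}
    (hx : Irrational x) : Irrational (hermiteAct T x) := by
  have h := irrational_moebius hx (a := T.1) (b := T.2.1) (c := 0) (d := T.2.2)
    (by rw [mul_zero, sub_zero]; exact_mod_cast hT.1.trans_ne hD.ne')
  simpa [hermiteAct] using h

/-- Every integral affine map of positive determinant is an integral translate of a reduced one. -/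
lemma exists_hermite_of_affine {D : ℕ} (hD : 0 < D) {x : ℝ} (α δ : ℕ) (b : ℤ) (h : α * δ = D)
    (s : ℝ) : ∃ T, IsHermite D T ∧ T.2.2 = δ ∧
      TailEquiv 0 ((α * x + b) / δ) s (hermiteAct T x) s := by
  have hδ : 0 < δ := Nat.pos_of_ne_zero (by rintro rfl; omega)
  have hδ' : (0 : ℤ) < δ := by exact_mod_cast hδ
  have h1 := Int.emod_nonneg b hδ'.ne'
  have h2 := Int.emod_lt_of_pos b hδ'
  have h3 : ((b % δ).toNat : ℤ) = b % δ := Int.toNat_of_nonneg h1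
  refine ⟨(α, (b % δ).toNat, δ), ⟨h, by show (b % δ).toNat < δ; omega⟩, rfl, ?_⟩
  have h4 := TailEquiv.add_int ((α * x + b) / δ) s (-(b / δ))
  convert h4 using 1
  have h5 : (((b % δ).toNat : ℕ) : ℝ) = b - δ * (b / δ : ℤ) := by
    rw [← Int.cast_natCast, h3, Int.emod_def]; push_cast; ring
  simp only [hermiteAct]
  rw [h5]
  push_cast
  field_simp
  ring

/-- Every integral Möbius transformation is reduced to an upper triangular one by a number of
steps controlled by its lower left entry. -/
lemma exists_hermite_of_moebius {D : ℕ} (hD : 0 < D) {x : ℝ} (hx : Irrational x) (n : ℕ) :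
    ∀ a b c d : ℤ, c.natAbs = n → (a * d - b * c).natAbs = D →
      ∃ T, IsHermite D T ∧ TailEquiv (7 * n + 3) ((a * x + b) / (c * x + d)) (1 / |c * x + d|)
        (hermiteAct T x) (1 / T.2.2) := by
  induction n using Nat.strong_induction_on with
  | _ n ih =>
    intro a b c d hc hdet
    have hy := irrational_moebius hx (a := a) (b := b) (c := c) (d := d) (by omega)
    by_cases hc0 : c = 0
    · subst hc0
      have hn : n = 0 := by simpa using hc.symm
      subst hn
      have hadD : a.natAbs * d.natAbs = D := by simpa [Int.natAbs_mul] using hdet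
      have hd0 : (d : ℝ) ≠ 0 := by
        rintro h
        have : d = 0 := by exact_mod_cast h
        subst this
        simp at hadD
        omega
      have habs : (d.natAbs : ℝ) = |(d : ℝ)| := by simp
      have haabs : (a.natAbs : ℝ) = |(a : ℝ)| := by simp
      obtain ⟨b', hb'⟩ : ∃ b' : ℤ,
          (a.natAbs * x + b') / d.natAbs = (a * x + b) / d ∨
          (a.natAbs * x + b') / d.natAbs = -((a * x + b) / d) := by
        rw [habs, haabs]
        rcases abs_choice (a : ℝ) with ha | ha <;> rcases abs_choice (d : ℝ) with hd | hd <;>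
          rw [ha, hd]
        · exact ⟨b, Or.inl (by simp)⟩
        · exact ⟨b, Or.inr (by rw [div_neg])⟩
        · exact ⟨-b, Or.inr (by push_cast; field_simp; ring)⟩
        · exact ⟨-b, Or.inl (by push_cast; field_simp; ring)⟩
      obtain ⟨T, hT, hTδ, h⟩ := exists_hermite_of_affine hD (x := x) _ _ b' hadD (1 / d.natAbs)
      refine ⟨T, hT, ?_⟩
      rw [hTδ, habs]
      rw [Int.cast_zero, zero_mul, zero_add] at hy ⊢
      rcases hb' with e | e
      · rw [e, habs] at h
        exact h.mono (by norm_num)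
      · rw [e, habs] at h
        exact (TailEquiv.neg hy _).trans h
    · have hr := Int.emod_nonneg a hc0
      have hr' := Int.emod_lt_abs a hc0
      rw [Int.abs_eq_natAbs] at hr'
      have hlt : (a % c).natAbs < n := by omega
      have hdet' : (c * (b - a / c * d) - d * (a % c)).natAbs = D := by
        rw [← hdet, ← Int.natAbs_neg, Int.emod_def]; congr 1; ring
      obtain ⟨T, hT, h⟩ := ih _ hlt c d (a % c) (b - a / c * d) rfl hdet'
      have hden : (c : ℝ) * x + d ≠ 0 := ((hx.intCast_mul hc0).add_intCast d).ne_zero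
      refine ⟨T, hT, ?_⟩
      have e : (a * x + b) / (c * x + d) + ((-(a / c) : ℤ) : ℝ)
          = (((a % c : ℤ) : ℝ) * x + ((b - a / c * d : ℤ) : ℝ)) / (c * x + d) := by
        rw [Int.emod_def, div_add' _ _ _ hden]; push_cast; ring
      have h1 := TailEquiv.add_int ((a * x + b) / (c * x + d)) (1 / |c * x + d|) (-(a / c))
      have hy' := hy.add_intCast (-(a / c))
      rw [e] at h1 hy'
      have h2 := TailEquiv.inv hy' (1 / |c * x + d|)
      rw [inv_div, abs_div, div_div_div_cancel_right₀ (abs_ne_zero.2 hden)] at h2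
      exact ((h1.trans h2).trans h).mono (by omega)

/-- Compatibility of the reduced matrices with one step of the Gauss map. -/
lemma exists_hermite_step {D : ℕ} (hD : 0 < D) {x : ℝ} (hx : Irrational x) {T : ℕ × ℕ × ℕ}
    (hT : IsHermite D T) : ∃ T', IsHermite D T' ∧
      TailEquiv (7 * D + 3) (hermiteAct T x) (1 / T.2.2) (hermiteAct T' (cfMap x))
        (cfMap x * (1 / T'.2.2)) := by
  obtain ⟨α, β, δ⟩ := T
  obtain ⟨h, hβ⟩ := hT
  dsimp only at h hβ
  have hz := one_lt_cfMap hx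
  have hzi := irrational_cfMap hx
  have hxz := eq_floor_add_inv_cfMap hx
  have hδ : (0 : ℝ) < δ := by exact_mod_cast (by omega : 0 < δ)
  obtain ⟨T', hT', h'⟩ := exists_hermite_of_moebius hD hzi δ (α * ⌊x⌋ + β) α δ 0 (by simp)
    (by rw [mul_zero, zero_sub, Int.natAbs_neg, Int.natAbs_mul]; simpa using h)
  have hδD : δ ≤ D := Nat.le_of_dvd hD ⟨α, by rw [← h, mul_comm]⟩
  refine ⟨T', hT', ?_⟩
  have h1 := (h'.scale (cfMap x)).mono (by omega : 7 * δ + 3 ≤ 7 * D + 3)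
  generalize cfMap x = z at *
  generalize ⌊x⌋ = a at *
  have hz0 : 0 < z := by linarith
  convert h1 using 1
  · simp only [hermiteAct]
    rw [hxz]
    push_cast
    field_simp
    ring
  · push_cast
    rw [add_zero, abs_of_pos (by positivity)]
    field_simp

/-! ### The main bound -/

/-- The reduced matrices `T n` such that `hermiteAct (T n) (cfMap^[n] x)` are all tail equivalent,
with bounded shift in each step. -/
lemma exists_hermite_seq {D : ℕ} (hD : 0 < D) {x : ℝ} (hx : Irrational x) {T₀ : ℕ × ℕ × ℕ}
    (hT₀ : IsHermite D T₀) : ∃ T : ℕ → ℕ × ℕ × ℕ, T 0 = T₀ ∧ (∀ n, IsHermite D (T n)) ∧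
      ∀ n, TailEquiv (7 * D + 3) (hermiteAct (T n) (cfMap^[n] x)) (1 / (T n).2.2)
        (hermiteAct (T (n + 1)) (cfMap^[n + 1] x))
        (cfMap^[n + 1] x * (1 / (T (n + 1)).2.2)) := by
  choose! next hnext using fun (n : ℕ) (T : ℕ × ℕ × ℕ) (hT : IsHermite D T) =>
    exists_hermite_step hD (irrational_iterate_cfMap hx n) hT
  let T : ℕ → ℕ × ℕ × ℕ := fun n => Nat.rec T₀ next n
  have hT : ∀ n, IsHermite D (T n) := fun n => by
    induction n with
    | zero => exact hT₀
    | succ n ih => exact (hnext n _ ih).1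
  refine ⟨T, rfl, hT, fun n => ?_⟩
  rw [Function.iterate_succ_apply']
  exact (hnext n _ (hT n)).2

lemma exists_tailEquiv_of_steps {k : ℕ} {y s w : ℕ → ℝ} (hw : ∀ n, 1 < w n)
    (h : ∀ n, TailEquiv k (y n) (s n) (y (n + 1)) (w n * s (n + 1))) (i j : ℕ) :
    ∃ r : ℝ, 1 ≤ r ∧ (0 < j → 1 < r) ∧
      TailEquiv (j * k) (y i) (s i) (y (i + j)) (r * s (i + j)) := by
  induction j with
  | zero => exact ⟨1, le_rfl, by simp, by simpa using TailEquiv.refl (y i) (s i)⟩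
  | succ j ih =>
    obtain ⟨r, hr, -, hj⟩ := ih
    have hlt : 1 < r * w (i + j) := by nlinarith [hw (i + j)]
    refine ⟨r * w (i + j), hlt.le, fun _ => hlt, ?_⟩
    rw [Nat.succ_mul, mul_assoc]
    exact hj.trans ((h (i + j)).scale r)

/-- Reduced matrices of determinant `D` enlarge eventual periods by a bounded factor only. -/
lemma exists_isOrbitPeriod_hermiteAct {D : ℕ} (hD : 0 < D) {x : ℝ} (hx : Irrational x) {p : ℕ}
    (hp : IsOrbitPeriod x p) {T₀ : ℕ × ℕ × ℕ} (hT₀ : IsHermite D T₀) :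
    ∃ q ≤ (D + 1) ^ 3 * p * (7 * D + 3), IsOrbitPeriod (hermiteAct T₀ x) q := by
  obtain ⟨hp0, N, hN⟩ := hp
  obtain ⟨T, hT0, hT, hstep⟩ := exists_hermite_seq hD hx hT₀
  have hper : ∀ j, cfMap^[N + j * p] x = cfMap^[N] x := by
    intro j
    induction j with
    | zero => simp
    | succ j ih =>
      rw [show N + (j + 1) * p = p + (N + j * p) by ring, Function.iterate_add_apply, ih,
        ← Function.iterate_add_apply, add_comm, hN]
  have hmaps : ∀ j ∈ Finset.range ((D + 1) ^ 3 + 1), T (N + j * p) ∈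
      Finset.range (D + 1) ×ˢ Finset.range (D + 1) ×ˢ Finset.range (D + 1) := by
    intro j _
    obtain ⟨h1, h2⟩ := hT (N + j * p)
    have h3 := Nat.le_of_dvd hD ⟨_, h1.symm⟩
    have h4 := Nat.le_of_dvd hD ⟨_, (mul_comm _ _).trans h1 |>.symm⟩
    simp only [Finset.mem_product, Finset.mem_range]
    omega
  have hcard : (Finset.range (D + 1) ×ˢ Finset.range (D + 1) ×ˢ Finset.range (D + 1)).card
      < (Finset.range ((D + 1) ^ 3 + 1)).card := by
    simp only [Finset.card_product, Finset.card_range]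
    exact Nat.lt_succ_of_le (le_of_eq (by ring))
  obtain ⟨i, hi, j, hj, hij, hTij⟩ : ∃ i ≤ (D + 1) ^ 3, ∃ j ≤ (D + 1) ^ 3, i < j ∧
      T (N + i * p) = T (N + j * p) := by
    obtain ⟨i, hi, j, hj, hij, h⟩ := Finset.exists_ne_map_eq_of_card_lt_of_maps_to hcard hmaps
    rw [Finset.mem_range] at hi hj
    rcases lt_or_gt_of_ne hij with h' | h'
    · exact ⟨i, by omega, j, by omega, h', h⟩
    · exact ⟨j, by omega, i, by omega, h', h.symm⟩
  have hw : ∀ n, 1 < cfMap^[n + 1] x := fun n => by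
    rw [Function.iterate_succ_apply']; exact one_lt_cfMap (irrational_iterate_cfMap hx n)
  have hchain := exists_tailEquiv_of_steps (y := fun n => hermiteAct (T n) (cfMap^[n] x))
    (s := fun n => 1 / ((T n).2.2 : ℝ)) (w := fun n => cfMap^[n + 1] x) hw hstep
  obtain ⟨r, -, hr, hloop⟩ := hchain (N + i * p) ((j - i) * p)
  have hsum : N + i * p + (j - i) * p = N + j * p := by
    rw [add_assoc, ← Nat.add_mul, Nat.add_sub_cancel' hij.le]
  simp only [hsum, ← hTij, hper] at hloop
  have hδ : (0 : ℝ) < 1 / (T (N + i * p)).2.2 := by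
    have := (hT (N + i * p)).2
    have h' : (0 : ℝ) < (T (N + i * p)).2.2 := by exact_mod_cast (by omega)
    positivity
  have hr1 := hr (Nat.mul_pos (by omega) hp0)
  obtain ⟨q, hq, hqper⟩ := hloop.exists_isOrbitPeriod
    (irrational_hermiteAct hD (hT _) (irrational_iterate_cfMap hx N)) (by nlinarith)
  refine ⟨q, hq.trans ?_, ?_⟩
  · gcongr
    omega
  · obtain ⟨-, -, -, m, n, -, -, h, -⟩ := hchain 0 (N + i * p)
    simp only [zero_add, hT0, hper, Function.iterate_zero, id_eq] at h
    exact hqper.of_iterate_eq h.symm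

/-- A bounded transfer of eventual periods in both directions bounds the period length. -/
lemma periodLength_le_of_transfer {x y : ℝ} {C : ℕ} (hxy : Irrational y → Irrational x)
    (h : ∀ p, IsOrbitPeriod x p → ∃ q ≤ C * p, IsOrbitPeriod y q)
    (h' : ∀ q, IsOrbitPeriod y q → ∃ p, IsOrbitPeriod x p) :
    periodLength y ≤ C * periodLength x := by
  by_cases hy : Irrational y
  · rw [periodLength_of_irrational hy, periodLength_of_irrational (hxy hy)]
    rcases Set.eq_empty_or_nonempty {q | IsOrbitPeriod y q} with he | ⟨q, hq⟩
    · simp [he]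
    · obtain ⟨q', hq', hper⟩ := h _ (Nat.sInf_mem (s := {p | IsOrbitPeriod x p}) (h' q hq))
      exact (Nat.sInf_le hper).trans hq'
  · simp [periodLength, hy]

lemma periodLength_mul_le {D : ℕ} (hD : 0 < D) (x : ℝ) :
    periodLength (D * x) ≤ (D + 1) ^ 3 * (7 * D + 3) * periodLength x ∧
      periodLength x ≤ (D + 1) ^ 3 * (7 * D + 3) * periodLength (D * x) := by
  have hirr : Irrational (D * x) ↔ Irrational x := by
    simp [irrational_natCast_mul_iff, hD.ne']
  by_cases hx : Irrational x
  · have hDx := hirr.2 hx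
    have hD0 : (D : ℝ) ≠ 0 := by exact_mod_cast hD.ne'
    have up : ∀ p, IsOrbitPeriod x p →
        ∃ q ≤ (D + 1) ^ 3 * (7 * D + 3) * p, IsOrbitPeriod (D * x) q := fun p hp => by
      obtain ⟨q, hq, h⟩ := exists_isOrbitPeriod_hermiteAct hD hx hp (T₀ := (D, 0, 1))
        ⟨by simp, by simp⟩
      exact ⟨q, hq.trans (by rw [mul_right_comm]), by simpa [hermiteAct] using h⟩
    have down : ∀ p, IsOrbitPeriod (D * x) p →
        ∃ q ≤ (D + 1) ^ 3 * (7 * D + 3) * p, IsOrbitPeriod x q := fun p hp => by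
      obtain ⟨q, hq, h⟩ := exists_isOrbitPeriod_hermiteAct hD hDx hp (T₀ := (1, 0, D))
        ⟨by simp, by simpa using hD⟩
      exact ⟨q, hq.trans (by rw [mul_right_comm]), by simpa [hermiteAct, hD0] using h⟩
    exact ⟨periodLength_le_of_transfer hirr.1 up fun q hq => (down q hq).imp fun _ h => h.2,
      periodLength_le_of_transfer hirr.2 down fun q hq => (up q hq).imp fun _ h => h.2⟩
  · have hDx := mt hirr.1 hx
    simp [periodLength, hx, hDx]

/-- multiplying a sequence in a real quadratic field by a fixed positive integer
does not affect boundedness of the period lengths of the continued fractions. -/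
theorem stmt_1 (K : IntermediateField ℚ ℝ) (hK : Module.finrank ℚ K = 2)
    (A : ℕ → K) (D : ℕ) (hD : 0 < D) :
    (∃ B : ℕ, ∀ n : ℕ, periodLength (A n : ℝ) ≤ B) ↔
      (∃ B : ℕ, ∀ n : ℕ, periodLength ((D : ℝ) * (A n : ℝ)) ≤ B) := by
  constructor
  · rintro ⟨B, hB⟩
    exact ⟨_, fun n => (periodLength_mul_le hD (A n : ℝ)).1.trans (Nat.mul_le_mul_left _ (hB n))⟩
  · rintro ⟨B, hB⟩
    exact ⟨_, fun n => (periodLength_mul_le hD (A n : ℝ)).2.trans (Nat.mul_le_mul_left _ (hB n))⟩
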